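/- Residuation distributes over p-sums: let p be a real number with 0 < p < ∞. For all a, b, c in ℝ≥0∞, c ⊸ (a ⊕ₚ b) = (c ⊸ a) ⊕ₚ (c ⊸ b) and (a &ₚ b) ⊸ c = (a ⊸ c) ⊕ₚ (b ⊸ c), where a ⊸ b := a⁻¹ ⊗* b. -/

import Mathlib

open ENNReal

/-- The p-sum on `ℝ≥0∞`: `a ⊕ₚ b = (a^p + b^p)^(1/p)` (via `ENNReal.rpow`). -/
noncomputable def pSum (p : ℝ) (a b : ℝ≥0∞) : ℝ≥0∞ := (a ^ p + b ^ p) ^ (1 / p)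

/-- The harmonic p-sum on `ℝ≥0∞`: `a &ₚ b = (((a^p)⁻¹ + (b^p)⁻¹)⁻¹)^(1/p)`. -/
noncomputable def pCoSum (p : ℝ) (a b : ℝ≥0∞) : ℝ≥0∞ :=
  (((a ^ p)⁻¹ + (b ^ p)⁻¹)⁻¹) ^ (1 / p)

/-- Disjunctive multiplication on `ℝ≥0∞`: `a ⊗* b = (a⁻¹ * b⁻¹)⁻¹`. -/
noncomputable def tensorStar (a b : ℝ≥0∞) : ℝ≥0∞ := (a⁻¹ * b⁻¹)⁻¹

/-- Residuation on `ℝ≥0∞`: `a ⊸ b = a⁻¹ ⊗* b`. -/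
noncomputable def resid (a b : ℝ≥0∞) : ℝ≥0∞ := tensorStar a⁻¹ b

theorem tensorStar_comm (a b : ℝ≥0∞) : tensorStar a b = tensorStar b a := by
  simp only [tensorStar, mul_comm]

theorem tensorStar_top_left (a : ℝ≥0∞) : tensorStar ∞ a = ∞ := by
  simp [tensorStar]

theorem tensorStar_top_right (a : ℝ≥0∞) : tensorStar a ∞ = ∞ := by
  simp [tensorStar]

theorem tensorStar_eq_mul {a b : ℝ≥0∞} (ha : a ≠ ∞) (hb : b ≠ ∞) :
    tensorStar a b = a * b := by
  rw [tensorStar, ENNReal.mul_inv (by simp [ha]) (by simp [hb]), inv_inv, inv_inv]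

theorem tensorStar_add (t a b : ℝ≥0∞) :
    tensorStar t (a + b) = tensorStar t a + tensorStar t b := by
  rcases eq_or_ne t ∞ with rfl | ht
  · simp [tensorStar_top_left]
  rcases eq_or_ne a ∞ with rfl | ha
  · simp [tensorStar_top_right]
  rcases eq_or_ne b ∞ with rfl | hb
  · simp [tensorStar_top_right]
  rw [tensorStar_eq_mul ht ha, tensorStar_eq_mul ht hb,
    tensorStar_eq_mul ht (add_ne_top.2 ⟨ha, hb⟩), mul_add]

theorem tensorStar_rpow {p : ℝ} (hp : 0 ≤ p) (a b : ℝ≥0∞) :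
    tensorStar a b ^ p = tensorStar (a ^ p) (b ^ p) := by
  simp only [tensorStar, ENNReal.inv_rpow, ENNReal.mul_rpow_of_nonneg _ _ hp]

theorem tensorStar_pSum {p : ℝ} (hp : 0 < p) (t a b : ℝ≥0∞) :
    tensorStar t (pSum p a b) = pSum p (tensorStar t a) (tensorStar t b) := by
  simp only [pSum, tensorStar_rpow hp.le, ← tensorStar_add]
  rw [tensorStar_rpow (one_div_nonneg.2 hp.le), ← ENNReal.rpow_mul,
    mul_one_div_cancel hp.ne', ENNReal.rpow_one]

theorem inv_pCoSum (p : ℝ) (a b : ℝ≥0∞) : (pCoSum p a b)⁻¹ = pSum p a⁻¹ b⁻¹ := by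
  simp only [pCoSum, pSum, ENNReal.inv_rpow, inv_inv]

/-- Residuation distributes over p-sums. -/
theorem resid_pSum_distrib (p : ℝ) (hp : 0 < p) (a b c : ℝ≥0∞) :
    resid c (pSum p a b) = pSum p (resid c a) (resid c b) ∧
    resid (pCoSum p a b) c = pSum p (resid a c) (resid b c) := by
  refine ⟨tensorStar_pSum hp _ _ _, ?_⟩
  simp only [resid, inv_pCoSum]
  rw [tensorStar_comm, tensorStar_pSum hp, tensorStar_comm c, tensorStar_comm c]
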